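/- arXiv:1509.04053 — 3 statements merged into one kernel-verified Lean document; each statement's English description precedes it below -/
import Mathlib

section
/- Let n ≥ 1, 0 < ϱ ≤ 1, R > 0, and let ω ⊂ B_R be a measurable set with |ω| ≥ ϱ|B_R|. Let f be a real-analytic function in B_R for which there are M > 0 such that |∂_x^α f(x)| ≤ M (Rϱ)^{−|α|} |α|! for all x ∈ B_R and all multi-indices α ∈ ℕⁿ. Then there are N = N(n,ϱ) and θ = θ(n,ϱ) ∈ (0,1), independent of R, f, M and ω, such that ‖f‖_{L^∞(B_R)} ≤ N M^{1−θ} ( (1/|ω|) ∫_ω |f| dx )^{θ}. -/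
open MeasureTheory Finset Set

noncomputable section

/-- Euclidean space ℝⁿ. -/
abbrev Esp (n : ℕ) : Type := EuclideanSpace ℝ (Fin n)

/-- Length of a multi-index. -/
def mdeg {n : ℕ} (α : Fin n → ℕ) : ℕ := ∑ i, α i

/-- Multi-indices of length ≤ N. -/
def idxLE (n N : ℕ) : Finset (Fin n → ℕ) :=
  (Fintype.piFinset fun _ => Finset.range (N + 1)).filter fun α => mdeg α ≤ N

/-- Multi-indices of length = N. -/
def idxEQ (n N : ℕ) : Finset (Fin n → ℕ) :=
  (Fintype.piFinset fun _ => Finset.range (N + 1)).filter fun α => mdeg α = N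

/-- Spatial partial derivative ∂_{x_i} of a space-time function. -/
def sder {n : ℕ} (i : Fin n) (u : Esp n → ℝ → ℝ) : Esp n → ℝ → ℝ :=
  fun x t => fderiv ℝ (fun y => u y t) x (EuclideanSpace.single i 1)

/-- Multi-index spatial derivative ∂_x^α of a space-time function. -/
def msder {n : ℕ} (α : Fin n → ℕ) (u : Esp n → ℝ → ℝ) : Esp n → ℝ → ℝ :=
  (List.finRange n).foldr (fun i v => (sder i)^[α i] v) u

/-- Time derivative ∂_t. -/
def tder {n : ℕ} (u : Esp n → ℝ → ℝ) : Esp n → ℝ → ℝ :=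
  fun x t => deriv (fun s => u x s) t

/-- Magnitude |D^k u| of all spatial derivatives of order k. -/
def Dmag {n : ℕ} (k : ℕ) (u : Esp n → ℝ → ℝ) : Esp n → ℝ → ℝ :=
  fun x t => Real.sqrt (∑ α ∈ idxEQ n k, (msder α u x t) ^ 2)

/-- L² norm over S × (0,1). -/
def L2 {n : ℕ} (S : Set (Esp n)) (u : Esp n → ℝ → ℝ) : ℝ :=
  Real.sqrt (∫ x in S, ∫ t in Ioo (0:ℝ) 1, (u x t) ^ 2)

/-- The parabolic operator L u = (−1)^m Σ_{|α|≤2m} a_α ∂_x^α u. -/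
def Lop {n : ℕ} (m : ℕ) (a : (Fin n → ℕ) → Esp n → ℝ → ℝ) (u : Esp n → ℝ → ℝ) :
    Esp n → ℝ → ℝ :=
  fun x t => (-1 : ℝ) ^ m * ∑ α ∈ idxLE n (2*m), a α x t * msder α u x t

/-- Uniform parabolicity on S × [0,1] with constant ϱ. -/
def UnifParabolic {n : ℕ} (m : ℕ) (a : (Fin n → ℕ) → Esp n → ℝ → ℝ)
    (S : Set (Esp n)) (ϱ : ℝ) : Prop :=
  (∀ x ∈ S, ∀ t ∈ Icc (0:ℝ) 1, ∀ ξ : Esp n,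
    ϱ * ‖ξ‖ ^ (2*m) ≤ ∑ α ∈ idxEQ n (2*m), a α x t * ∏ i, ξ i ^ α i) ∧
  (∃ C : (Fin n → ℕ) → ℝ,
    (∀ α ∈ idxLE n (2*m), ∀ x ∈ S, ∀ t ∈ Icc (0:ℝ) 1, |a α x t| ≤ C α) ∧
    ∑ α ∈ idxLE n (2*m), C α ≤ ϱ⁻¹)

/-- u belongs to C^∞(closure S × [0,1]). -/
def SmoothCyl {n : ℕ} (S : Set (Esp n)) (u : Esp n → ℝ → ℝ) : Prop :=
  ContDiffOn ℝ (⊤ : ℕ∞) (fun p : Esp n × ℝ => u p.1 p.2) (closure S ×ˢ Icc (0:ℝ) 1)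

/-- u and its spatial derivatives of order ≤ m−1 vanish on ∂S × (0,1]. -/
def BdryVanish {n : ℕ} (m : ℕ) (S : Set (Esp n)) (u : Esp n → ℝ → ℝ) : Prop :=
  ∀ α : Fin n → ℕ, mdeg α < m → ∀ x ∈ frontier S, ∀ t ∈ Ioc (0:ℝ) 1, msder α u x t = 0

/-- The W^{2m,1}_2 Schauder estimate holds on Ω with constant K. -/
def SchauderEst {n : ℕ} (m : ℕ) (a : (Fin n → ℕ) → Esp n → ℝ → ℝ)
    (Ω : Set (Esp n)) (K : ℝ) : Prop :=
  ∀ u F : Esp n → ℝ → ℝ, SmoothCyl Ω u →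
    (∀ x ∈ Ω, ∀ t ∈ Ioc (0:ℝ) 1, tder u x t + Lop m a u x t = F x t) →
    (∀ x ∈ Ω, u x 0 = 0) → BdryVanish m Ω u →
    L2 Ω (tder u) + ∑ α ∈ idxLE n (2*m), L2 Ω (msder α u) ≤ K * (L2 Ω F + L2 Ω u)

/-- Partial derivative ∂_{x_i} of a purely spatial function. -/
def pder {n : ℕ} (i : Fin n) (v : Esp n → ℝ) : Esp n → ℝ :=
  fun x => fderiv ℝ v x (EuclideanSpace.single i 1)

/-- Multi-index derivative ∂^α of a purely spatial function. -/
def mpder {n : ℕ} (α : Fin n → ℕ) (v : Esp n → ℝ) : Esp n → ℝ :=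
  (List.finRange n).foldr (fun i w => (pder i)^[α i] w) v

/-- Magnitude |D^k v| for a purely spatial function. -/
def DmagS {n : ℕ} (k : ℕ) (v : Esp n → ℝ) : Esp n → ℝ :=
  fun x => Real.sqrt (∑ α ∈ idxEQ n k, (mpder α v x) ^ 2)

/-- Spatial L² norm over S. -/
def L2sp {n : ℕ} (S : Set (Esp n)) (v : Esp n → ℝ) : ℝ :=
  Real.sqrt (∫ x in S, (v x) ^ 2)

/-- The Sobolev interpolation inequality holds on Ω with constant C. -/
def InterpIneq {n : ℕ} (m : ℕ) (Ω : Set (Esp n)) (C : ℝ) : Prop :=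
  ∀ k : ℕ, 1 ≤ k → k ≤ 2*m - 1 → ∀ v : Esp n → ℝ, ContDiffOn ℝ (⊤ : ℕ∞) v (closure Ω) →
    L2sp Ω (DmagS k v) ≤
      C * (L2sp Ω v ^ (((2*m - k : ℕ) : ℝ)/(2*(m:ℝ))) *
             L2sp Ω (DmagS (2*m) v) ^ ((k : ℝ)/(2*(m:ℝ))) + L2sp Ω v)

/-- σ = 1/(2m−1). -/
def σm (m : ℕ) : ℝ := 1 / (2*(m:ℝ) - 1)

/-- b = (2m−1)/(2m). -/
def bm (m : ℕ) : ℝ := (2*(m:ℝ) - 1) / (2*(m:ℝ))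

/-- The weight t^q e^{−θ t^{−σ}}. -/
def wt (m : ℕ) (θ q : ℝ) : ℝ → ℝ := fun t => t ^ q * Real.exp (-θ * t ^ (-(σm m)))

/-- Index of the last variable x_n. -/
def lastVar (n : ℕ) (h : 0 < n) : Fin n := ⟨n - 1, Nat.sub_lt h Nat.one_pos⟩

/-- Half ball B_r⁺ = B_r ∩ {x_n > 0}. -/
def halfBall (n : ℕ) (h : 0 < n) (r : ℝ) : Set (Esp n) :=
  Metric.ball 0 r ∩ {x | 0 < x (lastVar n h)}


theorem aux_prod (i d : ℕ) :
    ∏ j ∈ (Finset.range (i + d + 1)).erase i, |(i:ℝ) - j| = (i.factorial : ℝ) * d.factorial := by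
  induction d with
  | zero =>
    have h1 : (Finset.range (i + 0 + 1)).erase i = Finset.range i := by
      ext a; simp; omega
    rw [h1, ← Finset.prod_range_reflect]
    rw [← Finset.prod_range_add_one_eq_factorial]
    push_cast
    simp only [Nat.factorial_zero, Nat.cast_one, mul_one]
    apply Finset.prod_congr rfl
    intro j hj
    rw [Finset.mem_range] at hj
    rw [Nat.cast_sub (by omega), Nat.cast_sub (by omega)]
    push_cast
    rw [abs_of_nonneg] <;> · ring_nf; try positivity
  | succ d ih =>
    have h1 : (Finset.range (i + (d + 1) + 1)).erase i
        = insert (i + d + 1) ((Finset.range (i + d + 1)).erase i) := by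
      ext a; simp; omega
    rw [h1, Finset.prod_insert (by simp), ih, Nat.factorial_succ]
    push_cast
    have : |(i:ℝ) - (i + d + 1)| = d + 1 := by
      rw [abs_of_nonpos] <;> ring_nf
      have : (0:ℝ) ≤ d := by positivity
      linarith
    rw [this]; ring

theorem aux_prod' (m i : ℕ) (hi : i ≤ m) :
    ∏ j ∈ (Finset.range (m + 1)).erase i, |(i:ℝ) - j| = (i.factorial : ℝ) * (m - i).factorial := by
  obtain ⟨d, rfl⟩ := Nat.exists_eq_add_of_le hi
  rw [aux_prod]; simp

theorem aux_sum (m : ℕ) :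
    ∑ i ∈ Finset.range (m + 1), ((i.factorial : ℝ) * (m - i).factorial)⁻¹
      = 2 ^ m / m.factorial := by
  have h := Nat.sum_range_choose m
  have h2 : (2:ℝ) ^ m = ∑ i ∈ Finset.range (m + 1), (m.choose i : ℝ) := by
    exact_mod_cast h.symm
  rw [h2, Finset.sum_div]
  apply Finset.sum_congr rfl
  intro i hi
  have hi' : i ≤ m := by simpa [Nat.lt_succ_iff] using hi
  have := Nat.choose_mul_factorial_mul_factorial hi'
  have h3 : (m.choose i : ℝ) * i.factorial * (m - i).factorial = m.factorial := by exact_mod_cast this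
  have a1 : (i.factorial : ℝ) ≠ 0 := by positivity
  have a2 : ((m-i).factorial : ℝ) ≠ 0 := by positivity
  have a3 : (m.factorial : ℝ) ≠ 0 := by positivity
  field_simp
  linarith

theorem aux_poly (m : ℕ) (P : Polynomial ℝ) (hP : P.degree < ((m + 1 : ℕ) : WithBot ℕ))
    (p : ℕ → ℝ) (s L B t : ℝ) (hs : 0 < s) (hL : 0 ≤ L)
    (hgap : ∀ i j, i < j → j < m + 1 → s * ((j:ℝ) - i) ≤ p j - p i)
    (hB : ∀ i, i < m + 1 → |P.eval (p i)| ≤ B)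
    (ht : ∀ i, i < m + 1 → |t - p i| ≤ L) :
    |P.eval t| ≤ B * ((L / s) ^ m * (2 ^ m / m.factorial)) := by
  have hB0 : 0 ≤ B := (abs_nonneg _).trans (hB 0 (by omega))
  have hgap' : ∀ i j, i < m + 1 → j < m + 1 → s * |(i:ℝ) - j| ≤ |p i - p j| := by
    intro i j hi hj
    rcases lt_trichotomy i j with h | h | h
    · have h1 := hgap i j h hj
      rw [abs_sub_comm, abs_sub_comm (p i)]
      have : (i:ℝ) < j := by exact_mod_cast h
      rw [abs_of_pos (by linarith)]
      exact h1.trans (le_abs_self _)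
    · subst h; simp
    · have h1 := hgap j i h hi
      have : (j:ℝ) < i := by exact_mod_cast h
      rw [abs_of_pos (by linarith)]
      exact h1.trans (le_abs_self _)
  have hne : ∀ i j : ℕ, i ≠ j → 0 < |(i:ℝ) - j| := by
    intro i j hij
    rw [abs_pos, sub_ne_zero]; exact_mod_cast hij
  have hinj : Set.InjOn p (Finset.range (m + 1)) := by
    intro i hi j hj hij
    by_contra hne'
    have h1 := hgap' i j (by simpa using hi) (by simpa using hj)
    rw [hij, sub_self, abs_zero] at h1
    have := mul_pos hs (hne i j hne')
    linarith
  have hint := Lagrange.eq_interpolate (f := P) hinj (by simpa using hP)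
  have hev : P.eval t = ∑ i ∈ Finset.range (m + 1), P.eval (p i) *
      ∏ j ∈ (Finset.range (m + 1)).erase i, ((p i - p j)⁻¹ * (t - p j)) := by
    conv_lhs => rw [hint]
    rw [Lagrange.interpolate_apply, Polynomial.eval_finsetSum]
    apply Finset.sum_congr rfl
    intro i _
    rw [Polynomial.eval_mul, Polynomial.eval_C, Lagrange.basis, Polynomial.eval_prod]
    congr 1
    apply Finset.prod_congr rfl
    intro j _
    simp [Lagrange.basisDivisor]
  rw [hev, ← aux_sum, Finset.mul_sum, Finset.mul_sum]
  refine (Finset.abs_sum_le_sum_abs _ _).trans (Finset.sum_le_sum ?_)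
  intro i hi
  have hi' : i < m + 1 := by simpa using hi
  rw [abs_mul]
  refine mul_le_mul (hB i hi') ?_ (abs_nonneg _) hB0
  rw [Finset.abs_prod, ← aux_prod' m i (by omega), ← Finset.prod_inv_distrib]
  have hc : ((Finset.range (m + 1)).erase i).card = m := by
    rw [Finset.card_erase_of_mem hi]; simp
  calc ∏ j ∈ (Finset.range (m + 1)).erase i, |(p i - p j)⁻¹ * (t - p j)|
      ≤ ∏ j ∈ (Finset.range (m + 1)).erase i, ((L / s) * |(i:ℝ) - j|⁻¹) := by
        apply Finset.prod_le_prod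
        · intros; positivity
        · intro j hj
          rw [Finset.mem_erase, Finset.mem_range] at hj
          have h0 := hne i j (Ne.symm hj.1)
          have h1 := hgap' i j hi' hj.2
          have h2 := ht j hj.2
          rw [abs_mul, abs_inv]
          have h3 : |p i - p j|⁻¹ ≤ (s * |(i:ℝ) - j|)⁻¹ := by
            apply inv_anti₀ (by positivity) h1
          calc |p i - p j|⁻¹ * |t - p j| ≤ (s * |(i:ℝ) - j|)⁻¹ * L := by
                apply mul_le_mul h3 h2 (abs_nonneg _) (by positivity)
            _ = _ := by rw [mul_inv]; ring
    _ = _ := by rw [Finset.prod_mul_distrib, Finset.prod_const, hc]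

theorem aux_pts (s : ℝ) (hs : 0 < s) (k : ℕ) : ∀ (E : Set ℝ) , BddBelow E →
    ENNReal.ofReal (2 * k * s) ≤ volume E →
    ∃ p : ℕ → ℝ, (∀ i, i < k → p i ∈ E) ∧
      ∀ i j, i < j → j < k → s * ((j:ℝ) - i) ≤ p j - p i := by
  induction k with
  | zero => intro E _ _; exact ⟨fun _ => 0, by simp, by simp⟩
  | succ k ih =>
    intro E hb hE
    have hne : E.Nonempty := by
      by_contra h
      rw [Set.not_nonempty_iff_eq_empty] at h
      subst h
      simp at hE
      have : 0 < 2 * ((k:ℝ) + 1) * s := by positivity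
      linarith
    obtain ⟨t, htE, ht⟩ := exists_lt_of_csInf_lt hne (lt_add_of_pos_right (sInf E) hs)
    have hE' : ENNReal.ofReal (2 * k * s) ≤ volume (E ∩ Set.Ici (t + s)) := by
      have h1 : E ⊆ (E ∩ Set.Ici (t + s)) ∪ Set.Icc (sInf E) (sInf E + 2 * s) := by
        intro y hy
        by_cases h : t + s ≤ y
        · left; exact ⟨hy, h⟩
        · right
          exact ⟨csInf_le hb hy, by push Not at h; linarith⟩
      have h2 := (measure_mono (μ := volume) h1).trans (measure_union_le _ _)
      rw [Real.volume_Icc] at h2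
      have h3 : ENNReal.ofReal (2 * (k + 1 : ℕ) * s)
          = ENNReal.ofReal (2 * k * s) + ENNReal.ofReal (sInf E + 2 * s - sInf E) := by
        rw [← ENNReal.ofReal_add (by positivity) (by linarith)]
        congr 1; push_cast; ring
      rw [h3] at hE
      exact ENNReal.le_of_add_le_add_right ENNReal.ofReal_ne_top (hE.trans h2)
    obtain ⟨p, hp1, hp2⟩ := ih _ (hb.mono Set.inter_subset_left) hE'
    refine ⟨fun i => Nat.casesOn i t p, ?_, ?_⟩
    · rintro (_ | i) hi
      · exact htE
      · exact (hp1 i (by omega)).1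
    · rintro (_ | i) (_ | j) hij hj
      · omega
      · simp only
        have h0 : t + s ≤ p 0 := (hp1 0 (by omega)).2
        rcases Nat.eq_zero_or_pos j with rfl | h
        · simp; linarith
        · have := hp2 0 j h (by omega)
          push_cast at this ⊢
          change s * ((j:ℝ) + 1 - 0) ≤ p j - t
          linarith
      · omega
      · simp only
        have := hp2 i j (by omega) (by omega)
        push_cast
        linarith

/-- optimisation in the degree -/
theorem aux_opt (C : ℝ) (hC : 2 ≤ C) : ∃ θ : ℝ, 0 < θ ∧ θ < 1 ∧ ∀ ε y : ℝ, 0 < ε → y ≤ 1 →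
    (∀ k : ℕ, y ≤ C ^ k * ε + 2 * (1/2) ^ k) → y ≤ 5 * ε ^ θ := by
  have hl2 : 0 < Real.log 2 := Real.log_pos (by norm_num)
  have hlC : Real.log 2 ≤ Real.log C := Real.log_le_log (by norm_num) hC
  have hlC0 : 0 < Real.log C := by linarith
  refine ⟨Real.log 2 / (2 * Real.log C), by positivity, ?_, ?_⟩
  · rw [div_lt_one (by positivity)]; linarith
  intro ε y hε hy1 h
  set θ := Real.log 2 / (2 * Real.log C) with hθ
  have hθ0 : 0 < θ := by positivity
  have hθ1 : θ ≤ 1/2 := by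
    rw [hθ, div_le_div_iff₀ (by positivity) (by norm_num)]; linarith
  rcases le_or_gt 1 ε with h1 | h1
  · have := Real.one_le_rpow h1 hθ0.le
    linarith
  set X := -Real.log ε / (2 * Real.log C) with hX
  have hlε : Real.log ε < 0 := Real.log_neg hε h1
  have hX0 : 0 ≤ X := by apply div_nonneg <;> linarith
  set k := ⌊X⌋₊ with hk
  have hk1 : (k:ℝ) ≤ X := Nat.floor_le hX0
  have hk2 : X < k + 1 := Nat.lt_floor_add_one X
  have hXl : X * Real.log C = - Real.log ε / 2 := by rw [hX]; field_simp
  have e1 : C ^ k * ε ≤ ε ^ θ := by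
    have : C ^ k * ε = Real.exp (k * Real.log C + Real.log ε) := by
      rw [Real.exp_add, Real.exp_log hε, Real.exp_nat_mul, Real.exp_log (by linarith)]
    rw [this, Real.rpow_def_of_pos hε]
    apply Real.exp_le_exp.mpr
    have := mul_le_mul_of_nonneg_right hk1 hlC0.le
    nlinarith
  have e2 : 2 * (1/2:ℝ) ^ k ≤ 4 * ε ^ θ := by
    have : (1/2:ℝ) ^ k = Real.exp (- (k * Real.log 2)) := by
      rw [Real.exp_neg, Real.exp_nat_mul, Real.exp_log (by norm_num)]; simp
    rw [this, Real.rpow_def_of_pos hε]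
    have h4 : Real.exp (-(k * Real.log 2)) ≤ Real.exp (Real.log 2 + Real.log ε * θ) := by
      apply Real.exp_le_exp.mpr
      have : Real.log ε * θ = - X * Real.log 2 := by
        rw [hX, hθ]; field_simp
      rw [this]
      nlinarith
    rw [Real.exp_add, Real.exp_log (by norm_num)] at h4
    linarith
  have := h k
  linarith

/-- Local estimate. -/
theorem aux_local (κ : ℝ) (hκ : 0 < κ) (hκ1 : κ ≤ 1) : ∃ C : ℝ, 2 ≤ C ∧
    ∀ (A L a : ℝ), 0 < A → 0 < L → C * (A * L) ≤ 1 / 2 → ∀ g : ℝ → ℝ,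
    (∀ k : ℕ, ∃ P : Polynomial ℝ, P.degree < (k : WithBot ℕ) ∧
      ∀ t ∈ Set.Icc a (a + L), |g t - P.eval t| ≤ (A * (t - a)) ^ k) →
    ∀ (E : Set ℝ) (ε : ℝ), 0 < ε → E ⊆ Set.Icc a (a + L) → ENNReal.ofReal (κ * L) ≤ volume E →
    (∀ t ∈ E, |g t| ≤ ε) → ∀ t ∈ Set.Icc a (a + L), ∀ k : ℕ,
      |g t| ≤ C ^ k * ε + 2 * (1 / 2) ^ k := by
  have hC1 : 1 ≤ 4 / κ := by rw [le_div_iff₀ hκ]; linarith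
  refine ⟨4 / κ * Real.exp 1, ?_, ?_⟩
  · have := Real.add_one_le_exp 1
    nlinarith
  intro A L a hA hL hCq g H E ε hε hEs hE hgE t ht k
  set C := 4 / κ * Real.exp 1 with hC
  have hC2 : 1 ≤ C := by
    have := Real.add_one_le_exp 1
    nlinarith
  rcases k with _ | m
  · obtain ⟨P, hP, hP2⟩ := H 0
    have h := hP2 t ht
    have : P = 0 := by
      rw [← Polynomial.degree_eq_bot]
      simpa using hP
    subst this
    simp at h
    simp
    linarith
  obtain ⟨P, hP, hP2⟩ := H (m + 1)
  set q := A * L with hq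
  have hq0 : 0 < q := by positivity
  have hP3 : ∀ t ∈ Set.Icc a (a + L), |g t - P.eval t| ≤ q ^ (m + 1) := by
    intro t ht
    refine (hP2 t ht).trans ?_
    apply pow_le_pow_left₀
    · have := ht.1
      apply mul_nonneg hA.le; linarith
    · apply mul_le_mul_of_nonneg_left _ hA.le
      linarith [ht.2]
  set s := κ * L / (2 * (m + 1)) with hs
  have hs0 : 0 < s := by positivity
  obtain ⟨p, hp1, hp2⟩ := aux_pts s hs0 (m + 1) E ⟨a, fun y hy => (hEs hy).1⟩ (by
    convert hE using 2
    rw [hs]; push_cast; field_simp)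
  have hb := aux_poly m P hP p s L (ε + q ^ (m + 1)) t hs0 hL.le hp2 (by
    intro i hi
    have h1 := hgE _ (hp1 i hi)
    have h2 := hP3 _ (hEs (hp1 i hi))
    have h3 : |P.eval (p i)| ≤ |g (p i)| + |g (p i) - P.eval (p i)| := by
      have := abs_sub (g (p i)) (g (p i) - P.eval (p i))
      simpa using this
    linarith) (by
    intro i hi
    have h1 := hEs (hp1 i hi)
    rw [abs_le]
    constructor <;> linarith [h1.1, h1.2, ht.1, ht.2])
  have hK : (L / s) ^ m * (2 ^ m / m.factorial) ≤ C ^ (m + 1) := by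
    have h1 : L / s = 2 * (m + 1) / κ := by rw [hs]; field_simp
    have h2 := Real.pow_div_factorial_le_exp ((m:ℝ) + 1) (by positivity) m
    have h3 : (L / s) ^ m * (2 ^ m / m.factorial)
        = (4 / κ) ^ m * (((m:ℝ) + 1) ^ m / m.factorial) := by
      rw [h1, show (4:ℝ) / κ = 2 / κ * 2 by ring,
        show 2 * ((m:ℝ) + 1) / κ = 2 / κ * (m + 1) by ring, mul_pow, mul_pow]
      ring
    rw [h3, hC, mul_pow, ← Real.exp_nat_mul]
    push_cast
    rw [mul_one]
    apply mul_le_mul _ h2 (by positivity) (by positivity)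
    exact pow_le_pow_right₀ hC1 (Nat.le_succ m)
  have h5 : |P.eval t| ≤ (ε + q ^ (m + 1)) * C ^ (m + 1) :=
    hb.trans (mul_le_mul_of_nonneg_left hK (by positivity))
  have h6 : |g t| ≤ |P.eval t| + |g t - P.eval t| := by
    have := abs_add_le (P.eval t) (g t - P.eval t)
    simpa using this
  have h7 := hP3 t ht
  have h8 : (C * q) ^ (m + 1) ≤ (1 / 2) ^ (m + 1) := pow_le_pow_left₀ (by positivity) hCq _
  have h9 : q ^ (m + 1) ≤ (C * q) ^ (m + 1) := by
    apply pow_le_pow_left₀ hq0.le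
    nlinarith
  rw [mul_pow C q] at h8 h9
  nlinarith

theorem aux_oneD (A δ : ℝ) (hA : 0 < A) (hδ : 0 < δ) (hδ1 : δ ≤ 1) :
    ∃ N θ : ℝ, 0 < N ∧ 0 < θ ∧ θ < 1 ∧ ∀ g : ℝ → ℝ,
    (∀ c ∈ Set.Ico (0:ℝ) 1, ∀ k : ℕ, ∃ P : Polynomial ℝ, P.degree < (k : WithBot ℕ) ∧
      ∀ t ∈ Set.Icc c 1, |g t - P.eval t| ≤ (A * (t - c)) ^ k) →
    ∀ (E : Set ℝ) (ε : ℝ), 0 < ε → E ⊆ Set.Icc 0 1 → ENNReal.ofReal δ ≤ volume E →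
    (∀ t ∈ E, |g t| ≤ ε) → |g 0| ≤ N * ε ^ θ := by
  obtain ⟨C, hC, hloc⟩ := aux_local (δ / 2) (by linarith) (by linarith)
  obtain ⟨θ, hθ0, hθ1, hopt⟩ := aux_opt C hC
  obtain ⟨m, hm⟩ := exists_nat_gt (4 * C * A)
  have hm0 : (0:ℝ) < m := lt_of_le_of_lt (by positivity) hm
  have hmN : 0 < m := by exact_mod_cast hm0
  refine ⟨5 ^ m, θ ^ m, by positivity, by positivity, pow_lt_one₀ hθ0.le hθ1 hmN.ne', ?_⟩
  intro g H E ε hε hEs hE hgE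
  set h : ℝ := 1 / m with hh
  have hh0 : 0 < h := by positivity
  have hmh : m * h = 1 := by rw [hh]; field_simp
  have hCA : C * (A * (2 * h)) ≤ 1 / 2 := by
    have : C * (A * (2 * h)) = (4 * C * A) * h / 2 := by ring
    rw [this]; nlinarith
  have hg1 : ∀ t ∈ Set.Icc (0:ℝ) 1, |g t| ≤ 1 := by
    intro t ht
    obtain ⟨P, hP, hP2⟩ := H 0 (by simp) 0
    have h := hP2 t ht
    have : P = 0 := by
      rw [← Polynomial.degree_eq_bot]
      simpa using hP
    subst this
    simpa using h
  -- general local step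
  have step : ∀ (a L : ℝ), 0 ≤ a → a + L ≤ 1 → 0 < L → L ≤ 2 * h → ∀ (F : Set ℝ) (η : ℝ), 0 < η →
      F ⊆ Set.Icc a (a + L) → ENNReal.ofReal (δ / 2 * L) ≤ volume F → (∀ t ∈ F, |g t| ≤ η) →
      ∀ t ∈ Set.Icc a (a + L), |g t| ≤ 5 * η ^ θ := by
    intro a L ha haL hL hL2 F η hη hF hFv hgF t ht
    apply hopt η _ hη (hg1 t ⟨ha.trans ht.1, ht.2.trans haL⟩)
    refine hloc A L a hA hL (le_trans ?_ hCA) g ?_ F η hη hF hFv hgF t ht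
    · gcongr
    · intro k
      obtain ⟨P, hP, hP2⟩ := H a ⟨ha, by linarith⟩ k
      exact ⟨P, hP, fun t ht => hP2 t ⟨ht.1, ht.2.trans haL⟩⟩
  -- pigeonhole
  have hpig : ∃ j, j < m ∧ ENNReal.ofReal (δ * h) ≤ volume (E ∩ Set.Icc (j * h) (j * h + h)) := by
    by_contra hcon
    push Not at hcon
    have hcov : E ⊆ ⋃ j ∈ Finset.range m, E ∩ Set.Icc ((j:ℝ) * h) (j * h + h) := by
      intro y hy
      have hy1 := hEs hy
      simp only [Set.mem_iUnion]
      rcases eq_or_lt_of_le hy1.2 with h1 | h1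
      · refine ⟨m - 1, by simpa using hmN, hy, ?_⟩
        have : ((m - 1 : ℕ) : ℝ) = m - 1 := by rw [Nat.cast_sub hmN]; simp
        rw [this, h1]
        constructor <;> nlinarith
      · have hf := Nat.floor_le (a := y * m) (mul_nonneg hy1.1 hm0.le)
        have hf2 := Nat.lt_floor_add_one (y * m)
        have hyh : y * m * h = y := by rw [mul_assoc, hmh, mul_one]
        refine ⟨⌊y * m⌋₊, ?_, hy, ?_, ?_⟩
        · rw [Finset.mem_range, Nat.floor_lt (mul_nonneg hy1.1 hm0.le)]
          nlinarith
        · have := mul_le_mul_of_nonneg_right hf hh0.le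
          linarith
        · have := mul_le_mul_of_nonneg_right hf2.le hh0.le
          linarith
    have h1 := (measure_mono (μ := volume) hcov).trans (measure_biUnion_finset_le _ _)
    have h2 : ∑ j ∈ Finset.range m, volume (E ∩ Set.Icc ((j:ℝ) * h) (j * h + h))
        < ∑ j ∈ Finset.range m, ENNReal.ofReal (δ * h) := by
      apply ENNReal.sum_lt_sum_of_nonempty
      · exact ⟨0, by simpa using hmN⟩
      · intro j hj; exact hcon j (by simpa using hj)
    have h3 : ∑ j ∈ Finset.range m, ENNReal.ofReal (δ * h) = ENNReal.ofReal δ := by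
      rw [Finset.sum_const, Finset.card_range, nsmul_eq_mul, ← ENNReal.ofReal_natCast,
        ← ENNReal.ofReal_mul (by positivity)]
      congr 1
      rw [mul_left_comm, hmh, mul_one]
    rw [h3] at h2
    exact absurd (hE.trans h1) (not_le.mpr h2)
  obtain ⟨j, hj, hjE⟩ := hpig
  have hcell : ∀ i : ℕ, i < m → (i:ℝ) * h + h ≤ 1 := by
    intro i hi
    have : (i:ℝ) + 1 ≤ m := by exact_mod_cast hi
    nlinarith
  have chain : ∀ i, i ≤ j → ∀ t ∈ Set.Icc (((j - i : ℕ) : ℝ) * h) (((j - i : ℕ) : ℝ) * h + h),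
      |g t| ≤ 5 ^ (i + 1) * ε ^ (θ ^ (i + 1)) := by
    intro i
    induction i with
    | zero =>
      intro _ t ht
      simp only [Nat.sub_zero, zero_add, pow_one] at ht ⊢
      refine step (j * h) h (by positivity) (hcell j hj) hh0 (by linarith) _ ε hε
        Set.inter_subset_right (le_trans ?_ hjE) (fun t ht => hgE t ht.1) t ht
      apply ENNReal.ofReal_le_ofReal
      nlinarith
    | succ i ih =>
      intro hi t ht
      have ih' := ih (by omega)
      set b : ℕ := j - (i + 1) with hb
      have hb' : j - i = b + 1 := by omega
      rw [hb'] at ih'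
      push_cast at ih'
      have hc := hcell (b + 1) (by omega)
      push_cast at hc
      have hstep := step (b * h) (2 * h) (by positivity) (by linarith) (by linarith) le_rfl
        (Set.Icc (((b:ℝ) + 1) * h) ((b + 1) * h + h)) (5 ^ (i + 1) * ε ^ (θ ^ (i + 1)))
        (by positivity) (by
          intro y hy
          constructor
          · nlinarith [hy.1]
          · linarith [hy.2]) (by
          rw [Real.volume_Icc]
          apply ENNReal.ofReal_le_ofReal
          nlinarith) ih' t ⟨ht.1, by linarith [ht.2]⟩
      refine hstep.trans ?_
      rw [Real.mul_rpow (by positivity) (by positivity), ← Real.rpow_mul hε.le, ← pow_succ,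
        ← mul_assoc]
      apply mul_le_mul_of_nonneg_right _ (by positivity)
      have : ((5:ℝ) ^ (i + 1)) ^ θ ≤ (5 ^ (i + 1)) ^ (1:ℝ) :=
        Real.rpow_le_rpow_of_exponent_le (one_le_pow₀ (by norm_num)) hθ1.le
      rw [Real.rpow_one] at this
      rw [pow_succ _ (i + 1)]
      linarith
  rcases le_or_gt 1 ε with h1 | h1
  · have h2 := hg1 0 (by simp)
    have h3 := Real.one_le_rpow h1 (pow_nonneg hθ0.le m)
    have h4 : (1:ℝ) ≤ 5 ^ m := one_le_pow₀ (by norm_num)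
    nlinarith
  · have h2 := chain j le_rfl 0 (by simp [hh0.le])
    refine h2.trans ?_
    apply mul_le_mul _ _ (by positivity) (by positivity)
    · exact pow_le_pow_right₀ (by norm_num) hj
    · apply Real.rpow_le_rpow_of_exponent_ge hε h1.le
      exact pow_le_pow_of_le_one hθ0.le hθ1.le hj

/-- iterated directional derivatives -/
def dl {n : ℕ} (l : List (Esp n)) (u : Esp n → ℝ) : Esp n → ℝ :=
  l.foldr (fun e w y => fderiv ℝ w y e) u

theorem dl_cons {n : ℕ} (e : Esp n) (l : List (Esp n)) (u : Esp n → ℝ) :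
    dl (e :: l) u = fun y => fderiv ℝ (dl l u) y e := rfl

theorem dl_analytic {n : ℕ} {U : Set (Esp n)} (l : List (Esp n)) (u : Esp n → ℝ)
    (hu : AnalyticOnNhd ℝ u U) : AnalyticOnNhd ℝ (dl l u) U := by
  induction l with
  | nil => exact hu
  | cons e l ih =>
    rw [dl_cons]
    exact (ContinuousLinearMap.apply ℝ ℝ e).comp_analyticOnNhd ih.fderiv

theorem dl_perm {n : ℕ} {U : Set (Esp n)} (hU : IsOpen U) (u : Esp n → ℝ)
    (hu : AnalyticOnNhd ℝ u U) {l₁ l₂ : List (Esp n)} (h : l₁.Perm l₂) :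
    Set.EqOn (dl l₁ u) (dl l₂ u) U := by
  induction h with
  | nil => exact fun _ _ => rfl
  | cons e h ih =>
    intro y hy
    rw [dl_cons, dl_cons]
    have : dl _ u =ᶠ[nhds y] dl _ u := ih.eventuallyEq_of_mem (hU.mem_nhds hy)
    simp only [this.fderiv_eq]
  | swap a b l =>
    intro y hy
    have han := dl_analytic l u hu
    have hd : DifferentiableAt ℝ (fderiv ℝ (dl l u)) y := (han.fderiv y hy).differentiableAt
    have hs : IsSymmSndFDerivAt ℝ (dl l u) y :=
      ((han y hy).contDiffAt (n := 2)).isSymmSndFDerivAt (by simp)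
    have key : ∀ a b : Esp n, dl (b :: a :: l) u y
        = fderiv ℝ (fderiv ℝ (dl l u)) y b a := by
      intro a b
      rw [dl_cons, dl_cons]
      simp only
      rw [fderiv_clm_apply hd (differentiableAt_const a)]
      simp
    rw [key, key]
    exact hs b a
  | trans _ _ ih1 ih2 => exact ih1.trans ih2

theorem dl_append {n : ℕ} (l₁ l₂ : List (Esp n)) (u : Esp n → ℝ) :
    dl (l₁ ++ l₂) u = dl l₁ (dl l₂ u) := by
  simp [dl, List.foldr_append]

theorem dl_replicate {n : ℕ} (i : Fin n) (k : ℕ) (u : Esp n → ℝ) :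
    dl (List.replicate k (EuclideanSpace.single i (1:ℝ))) u = (pder i)^[k] u := by
  induction k with
  | zero => rfl
  | succ k ih => rw [List.replicate_succ, dl_cons, ih, Function.iterate_succ_apply']; rfl

theorem mpder_eq_dl {n : ℕ} (α : Fin n → ℕ) (u : Esp n → ℝ) :
    mpder α u = dl (((List.finRange n).flatMap fun i => List.replicate (α i) i).map
      fun i => EuclideanSpace.single i (1:ℝ)) u := by
  unfold mpder
  induction List.finRange n with
  | nil => rfl
  | cons i l ih =>
    rw [List.foldr_cons, ih, List.flatMap_cons, List.map_append, dl_append, List.map_replicate,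
      dl_replicate]

theorem count_flat {n : ℕ} (α : Fin n → ℕ) (a : Fin n) (l : List (Fin n)) (hl : l.Nodup) :
    List.count a (l.flatMap fun i => List.replicate (α i) i) = if a ∈ l then α a else 0 := by
  induction l with
  | nil => simp
  | cons i l ih =>
    rw [List.nodup_cons] at hl
    rw [List.flatMap_cons, List.count_append, ih hl.2, List.count_replicate]
    by_cases h : i = a
    · subst h; simp [hl.1]
    · have h' : ¬ a = i := fun h2 => h h2.symm
      simp [h, h']

theorem dl_word {n : ℕ} {U : Set (Esp n)} (hU : IsOpen U) (u : Esp n → ℝ)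
    (hu : AnalyticOnNhd ℝ u U) (w : List (Fin n)) :
    Set.EqOn (dl (w.map fun i => EuclideanSpace.single i (1:ℝ)) u)
      (mpder (fun i => w.count i) u) U := by
  rw [mpder_eq_dl]
  apply dl_perm hU u hu
  apply List.Perm.map
  rw [List.perm_iff_count]
  intro a
  rw [count_flat _ _ _ (List.nodup_finRange n)]
  simp

theorem mdeg_count {n : ℕ} (w : List (Fin n)) : mdeg (fun i => w.count i) = w.length := by
  unfold mdeg
  induction w with
  | nil => simp
  | cons a w ih => simp [List.count_cons, Finset.sum_add_distrib, ih]

theorem iter_eq_dl {n : ℕ} {U : Set (Esp n)} (u : Esp n → ℝ)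
    (hu : AnalyticOnNhd ℝ u U) (k : ℕ) (m : Fin k → Esp n) (hU : IsOpen U) :
    ∀ y ∈ U, iteratedFDeriv ℝ k u y m = dl (List.ofFn m) u y := by
  induction k with
  | zero => intro y _; simp [dl]
  | succ k ih =>
    intro y hy
    rw [iteratedFDeriv_succ_apply_left, List.ofFn_succ, dl_cons]
    have hd : DifferentiableAt ℝ (iteratedFDeriv ℝ k u) y :=
      ((hu.iteratedFDeriv k) y hy).differentiableAt
    have he : dl (List.ofFn (Fin.tail m)) u =ᶠ[nhds y]
        fun z => iteratedFDeriv ℝ k u z (Fin.tail m) := by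
      filter_upwards [hU.mem_nhds hy] with z hz
      exact (ih (Fin.tail m) z hz).symm
    change _ = fderiv ℝ (dl (List.ofFn (Fin.tail m)) u) y (m 0)
    rw [he.fderiv_eq]
    have := (ContinuousMultilinearMap.apply ℝ (fun _ : Fin k => Esp n) ℝ
      (Fin.tail m)).hasFDerivAt.comp y hd.hasFDerivAt
    have h2 : HasFDerivAt (fun z => iteratedFDeriv ℝ k u z (Fin.tail m)) _ y := this
    rw [h2.fderiv]
    simp

theorem iter_bound {n : ℕ} {U : Set (Esp n)} (hU : IsOpen U) (u : Esp n → ℝ)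
    (hu : AnalyticOnNhd ℝ u U) (k : ℕ) (B S : ℝ) (v : Esp n) (hv : ∀ i, |v i| ≤ S) (y : Esp n)
    (hy : y ∈ U) (hB : ∀ α : Fin n → ℕ, mdeg α = k → |mpder α u y| ≤ B) :
    |iteratedFDeriv ℝ k u y (fun _ => v)| ≤ B * (n * S) ^ k := by
  have hv' : v = ∑ i : Fin n, v i • EuclideanSpace.single i (1:ℝ) := by
    ext j; simp [Pi.single_apply]
  have h1 : iteratedFDeriv ℝ k u y (fun _ => v) = ∑ r : Fin k → Fin n, (∏ j, v (r j)) *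
      iteratedFDeriv ℝ k u y (fun j => EuclideanSpace.single (r j) (1:ℝ)) := by
    conv_lhs => rw [hv']
    rw [ContinuousMultilinearMap.map_sum]
    apply Finset.sum_congr rfl
    intro r _
    rw [ContinuousMultilinearMap.map_smul_univ, smul_eq_mul]
  rw [h1]
  refine (Finset.abs_sum_le_sum_abs _ _).trans ?_
  have h2 : ∀ r ∈ (Finset.univ : Finset (Fin k → Fin n)), |(∏ j, v (r j)) *
      iteratedFDeriv ℝ k u y (fun j => EuclideanSpace.single (r j) (1:ℝ))| ≤ S ^ k * B := by
    intro r _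
    rw [abs_mul]
    apply mul_le_mul _ _ (abs_nonneg _)
    · rcases k with _ | k
      · simp
      · have : 0 ≤ S := (abs_nonneg _).trans (hv (r 0))
        positivity
    · rw [Finset.abs_prod]
      refine (Finset.prod_le_prod (fun _ _ => abs_nonneg _) (fun j _ => hv (r j))).trans ?_
      simp
    · rw [iter_eq_dl u hu k _ hU y hy]
      have := dl_word hU u hu (List.ofFn r) hy
      rw [List.map_ofFn] at this
      change |dl (List.ofFn ((fun i => EuclideanSpace.single i (1:ℝ)) ∘ r)) u y| ≤ B
      rw [this]
      apply hB
      rw [mdeg_count]; simp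
  refine (Finset.sum_le_sum h2).trans ?_
  simp [mul_pow]
  apply le_of_eq; ring

theorem line_taylor {n : ℕ} {U : Set (Esp n)} (hU : IsOpen U) (u : Esp n → ℝ)
    (hu : AnalyticOnNhd ℝ u U) (x v : Esp n) (hx : ∀ t ∈ Set.Icc (0:ℝ) 1, x + t • v ∈ U)
    (D : ℝ) (hD : 0 < D)
    (hb : ∀ k, ∀ y ∈ U, |iteratedFDeriv ℝ k u y (fun _ => v)| ≤ D ^ k * k.factorial) :
    ∀ c ∈ Set.Ico (0:ℝ) 1, ∀ k : ℕ, ∃ P : Polynomial ℝ, P.degree < (k : WithBot ℕ) ∧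
      ∀ t ∈ Set.Icc c 1, |u (x + t • v) - P.eval t| ≤ (2 * D * (t - c)) ^ k := by
  intro c hc k
  set g : ℝ → ℝ := fun t => u (x + t • v) with hg
  set G : ℕ → ℝ → ℝ := fun k t => iteratedFDeriv ℝ k u (x + t • v) (fun _ => v) with hG
  have hsub : Set.Icc c 1 ⊆ Set.Icc (0:ℝ) 1 := Set.Icc_subset_Icc_left hc.1
  have hGd : ∀ k, ∀ t ∈ Set.Icc (0:ℝ) 1, HasDerivAt (G k) (G (k+1) t) t := by
    intro k t ht
    have hd : DifferentiableAt ℝ (iteratedFDeriv ℝ k u) (x + t • v) :=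
      ((hu.iteratedFDeriv k) _ (hx t ht)).differentiableAt
    have h1 := (ContinuousMultilinearMap.apply ℝ (fun _ : Fin k => Esp n) ℝ
      (fun _ => v)).hasFDerivAt.comp (x + t • v) hd.hasFDerivAt
    have h2 : HasDerivAt (fun s : ℝ => x + s • v) v t := by
      simpa using ((hasDerivAt_id t).smul_const v).const_add x
    have h3 := h1.comp_hasDerivAt t h2
    have e : G (k + 1) t = fderiv ℝ (iteratedFDeriv ℝ k u) (x + t • v) v (fun _ => v) :=
      iteratedFDeriv_succ_apply_left (𝕜 := ℝ) (f := u) (x := x + t • v) (fun _ => v)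
    rw [e]
    exact h3
  have hud : UniqueDiffOn ℝ (Set.Icc c 1) := uniqueDiffOn_Icc hc.2
  have hGi : ∀ k, ∀ t ∈ Set.Icc c 1, iteratedDerivWithin k g (Set.Icc c 1) t = G k t := by
    intro k
    induction k with
    | zero => intro t _; simp [hG, hg]
    | succ k ih =>
      intro t ht
      rw [iteratedDerivWithin_succ, derivWithin_congr ih (ih t ht)]
      exact (hGd k t (hsub ht)).hasDerivWithinAt.derivWithin (hud t ht)
  rcases k with _ | m
  · refine ⟨0, by simp, ?_⟩
    intro t ht
    have := hb 0 _ (hx t (hsub ht))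
    simpa using this
  have hcd : ContDiffOn ℝ ((m:ℕ) + 1) g (Set.Icc c 1) := by
    intro t ht
    have h1 : AnalyticAt ℝ (fun s : ℝ => x + s • v) t := by fun_prop
    have h2 : AnalyticAt ℝ g t := AnalyticAt.comp (g := u) (f := fun s : ℝ => x + s • v) (hu _ (hx t (hsub ht))) h1
    exact h2.contDiffAt.contDiffWithinAt
  refine ⟨∑ k ∈ Finset.range (m + 1), Polynomial.C ((k.factorial : ℝ)⁻¹ *
    iteratedDerivWithin k g (Set.Icc c 1) c) * (Polynomial.X - Polynomial.C c) ^ k, ?_, ?_⟩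
  · rw [← Polynomial.mem_degreeLT]
    apply Submodule.sum_mem
    intro i hi
    rw [Polynomial.mem_degreeLT]
    refine lt_of_le_of_lt (b := (i : WithBot ℕ)) ?_ ?_
    · have h0 : ((Polynomial.X - Polynomial.C c) ^ i).degree ≤ (i : WithBot ℕ) := by
        rw [Polynomial.degree_pow, Polynomial.degree_X_sub_C]; simp
      exact (Polynomial.degree_mul_le_of_le Polynomial.degree_C_le h0).trans (by rw [zero_add])
    · exact_mod_cast Finset.mem_range.mp hi
  · intro t ht
    have h1 := taylor_mean_remainder_bound (C := D ^ (m+1) * (m+1).factorial) hc.2.le hcd ht (by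
      intro y hy
      rw [hGi _ y hy]
      exact hb _ _ (hx y (hsub hy)))
    rw [taylor_within_apply, Real.norm_eq_abs] at h1
    rw [Polynomial.eval_finsetSum]
    have h2 : ∑ k ∈ Finset.range (m + 1), Polynomial.eval t (Polynomial.C ((k.factorial : ℝ)⁻¹ *
      iteratedDerivWithin k g (Set.Icc c 1) c) * (Polynomial.X - Polynomial.C c) ^ k)
      = ∑ k ∈ Finset.range (m + 1), ((k.factorial : ℝ)⁻¹ * (t - c) ^ k) •
        iteratedDerivWithin k g (Set.Icc c 1) c := by
      apply Finset.sum_congr rfl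
      intro i _
      simp
      ring
    rw [h2]
    refine h1.trans ?_
    have h3 : D ^ (m + 1) * ((m + 1).factorial : ℝ) * (t - c) ^ (m + 1) / (m.factorial : ℝ)
        = (m + 1) * (D * (t - c)) ^ (m + 1) := by
      rw [Nat.factorial_succ]
      push_cast
      have : (m.factorial : ℝ) ≠ 0 := by positivity
      rw [mul_pow]
      field_simp
    rw [h3, mul_assoc 2 D, mul_pow 2]
    have htc : 0 ≤ t - c := by linarith [ht.1]
    apply mul_le_mul_of_nonneg_right _ (by positivity)
    have : m + 1 < 2 ^ (m + 1) := Nat.lt_two_pow_self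
    exact_mod_cast this.le

theorem geom {n : ℕ} (hn : 0 < n) (ϱ R : ℝ) (hϱ0 : 0 < ϱ) (hϱ1 : ϱ ≤ 1) (hR : 0 < R)
    (ω : Set (Esp n)) (hω : MeasurableSet ω) (hωs : ω ⊆ Metric.ball 0 R)
    (hv : ϱ / 2 * volume.real (Metric.ball (0 : Esp n) R) ≤ volume.real ω)
    (x : Esp n) (hx : x ∈ Metric.ball (0 : Esp n) R) :
    ∃ y ∈ Metric.ball (0 : Esp n) R, ENNReal.ofReal (ϱ ^ 2 / (32 * n)) ≤
      volume {t : ℝ | t ∈ Set.Icc (0:ℝ) 1 ∧ x + t • (y - x) ∈ ω} := by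
  set B := Metric.ball (0 : Esp n) R with hB
  have hBm : MeasurableSet B := Metric.isOpen_ball.measurableSet
  have hBfin : volume B ≠ ⊤ := measure_ball_lt_top.ne
  have hV0 : 0 < volume.real B := by
    rw [measureReal_def]
    exact ENNReal.toReal_pos (Metric.measure_ball_pos _ _ hR).ne' hBfin
  have hn0 : (0:ℝ) < n := by exact_mod_cast hn
  have hn1 : (1:ℝ) ≤ n := by exact_mod_cast hn
  set l0 : ℝ := 1 - ϱ / (4 * n) with hl0
  have hq0 : 0 < ϱ / (4 * n) := by positivity
  have hq1 : ϱ / (4 * n) < 1 := by rw [div_lt_one (by positivity)]; linarith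
  have hl0pos : 0 < l0 := by linarith
  -- fibres
  have hfib : ∀ l ∈ Set.Ioo l0 1, ϱ / 4 * volume.real B ≤
      volume.real (B ∩ {y | x + l • (y - x) ∈ ω}) := by
    intro l hl
    have hlpos : 0 < l := hl0pos.trans hl.1
    set T := AffineMap.homothety x l with hT
    have hTa : ∀ y, T y = x + l • (y - x) := by
      intro y; rw [hT, AffineMap.homothety_apply]; simp [add_comm]
    have hln : 1 - ϱ / 4 ≤ l ^ n := by
      have h1 := one_add_mul_le_pow (a := l - 1) (by linarith) n
      have h2 : (n:ℝ) * (ϱ / (4 * n)) = ϱ / 4 := by field_simp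
      have h3 := mul_le_mul_of_nonneg_left hl.1.le hn0.le
      have h4 : 1 + (l - 1) = l := by ring
      rw [h4] at h1
      have : (n:ℝ) * l0 = n - ϱ / 4 := by rw [hl0, mul_sub, h2]; ring
      linarith
    have hln1 : l ^ n ≤ 1 := pow_le_one₀ hlpos.le hl.2.le
    have himg : ∀ s : Set (Esp n), volume.real (T '' s) = l ^ n * volume.real s := by
      intro s
      rw [measureReal_def, Measure.addHaar_image_homothety, ENNReal.toReal_mul, measureReal_def]
      simp only [finrank_euclideanSpace, Fintype.card_fin]
      rw [abs_of_pos (by positivity), ENNReal.toReal_ofReal (by positivity)]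
    have hTB : T '' B ⊆ B := by
      rintro _ ⟨y, hy, rfl⟩
      rw [hTa]
      have := (convex_ball (0 : Esp n) R).add_smul_sub_mem hx hy ⟨hlpos.le, hl.2.le⟩
      exact this
    have hTBm : MeasurableSet (T '' B) :=
      ((AffineMap.homothety_isOpenMap x l hlpos.ne') _ Metric.isOpen_ball).measurableSet
    have h1 : volume.real (B \ T '' B) = volume.real B - l ^ n * volume.real B := by
      rw [measureReal_sdiff hTB hTBm hBfin, himg]
    have hsub : ω ⊆ (T '' (B ∩ {y | x + l • (y - x) ∈ ω})) ∪ (B \ T '' B) := by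
      intro z hz
      by_cases hzT : z ∈ T '' B
      · left
        obtain ⟨y, hy, rfl⟩ := hzT
        refine ⟨y, ⟨hy, ?_⟩, rfl⟩
        rw [hTa] at hz
        exact hz
      · right; exact ⟨hωs hz, hzT⟩
    have hfin : volume ((T '' (B ∩ {y | x + l • (y - x) ∈ ω})) ∪ (B \ T '' B)) ≠ ⊤ := by
      refine ((measure_mono (?_ : _ ⊆ B)).trans_lt hBfin.lt_top).ne
      apply Set.union_subset _ Set.sdiff_subset
      exact (Set.image_mono Set.inter_subset_left).trans hTB
    have h2 := (measureReal_mono hsub hfin).trans (measureReal_union_le _ _)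
    rw [h1, himg] at h2
    have h3 : 0 ≤ volume.real (B ∩ {y | x + l • (y - x) ∈ ω}) := measureReal_nonneg
    nlinarith
  by_contra hcon
  push Not at hcon
  set S : Set (Esp n × ℝ) := {p | p.1 ∈ B ∧ p.2 ∈ Set.Ioo l0 1 ∧ x + p.2 • (p.1 - x) ∈ ω} with hS
  have hSm : MeasurableSet S := by
    have m1 : MeasurableSet {p : Esp n × ℝ | p.1 ∈ B} := measurable_fst hBm
    have m2 : MeasurableSet {p : Esp n × ℝ | p.2 ∈ Set.Ioo l0 1} := measurable_snd measurableSet_Ioo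
    have m3 : MeasurableSet {p : Esp n × ℝ | x + p.2 • (p.1 - x) ∈ ω} := by
      have : Continuous fun p : Esp n × ℝ => x + p.2 • (p.1 - x) := by fun_prop
      exact this.measurable hω
    exact m1.inter (m2.inter m3)
  have e1 : ((volume : Measure (Esp n)).prod (volume : Measure ℝ)) S
      ≤ ENNReal.ofReal (ϱ ^ 2 / (32 * n)) * volume B := by
    rw [Measure.prod_apply hSm, ← setLIntegral_const, ← lintegral_indicator hBm]
    apply lintegral_mono
    intro y
    by_cases hy : y ∈ B
    · simp only [Set.indicator_of_mem hy]
      refine le_trans (measure_mono ?_) (hcon y hy).le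
      intro t ht
      exact ⟨⟨(hl0pos.trans ht.2.1.1).le, ht.2.1.2.le⟩, ht.2.2⟩
    · have : Prod.mk y ⁻¹' S = ∅ := by
        ext t; simp [hS, hy]
      simp [this]
  have e2 : ENNReal.ofReal (ϱ / 4 * volume.real B) * ENNReal.ofReal (1 - l0)
      ≤ ((volume : Measure (Esp n)).prod (volume : Measure ℝ)) S := by
    rw [Measure.prod_apply_symm hSm, ← Real.volume_Ioo, ← setLIntegral_const,
      ← lintegral_indicator measurableSet_Ioo]
    apply lintegral_mono
    intro l
    by_cases hl : l ∈ Set.Ioo l0 1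
    · simp only [Set.indicator_of_mem hl]
      refine (ENNReal.ofReal_le_ofReal (hfib l hl)).trans ?_
      rw [measureReal_def, ENNReal.ofReal_toReal]
      · apply measure_mono
        rintro y ⟨hy1, hy2⟩
        exact ⟨hy1, hl, hy2⟩
      · exact ((measure_mono Set.inter_subset_left).trans_lt hBfin.lt_top).ne
    · simp [Set.indicator_of_notMem hl]
  have e3 := e2.trans e1
  rw [← ENNReal.ofReal_toReal hBfin, ← ENNReal.ofReal_mul (by positivity),
    ← ENNReal.ofReal_mul (by positivity), ENNReal.ofReal_le_ofReal_iff (by positivity)] at e3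
  rw [← measureReal_def] at e3
  have e4 : ϱ / 4 * volume.real B * (1 - l0) = 2 * (ϱ ^ 2 / (32 * n) * volume.real B) := by
    rw [hl0]; field_simp; ring
  have : 0 < ϱ ^ 2 / (32 * n) * volume.real B := by positivity
  linarith

/-- propagation of smallness from measurable sets for analytic functions
(Lemma `propagation`). -/
theorem stmt9 (n : ℕ) (hn : 0 < n) (ϱ : ℝ) (hϱ0 : 0 < ϱ) (hϱ1 : ϱ ≤ 1) :
    ∃ N θ : ℝ, 0 < θ ∧ θ < 1 ∧
      ∀ R : ℝ, 0 < R → ∀ ω : Set (Esp n), MeasurableSet ω →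
        ω ⊆ Metric.ball (0 : Esp n) R →
        ϱ * (volume (Metric.ball (0 : Esp n) R)).toReal ≤ (volume ω).toReal →
      ∀ (f : Esp n → ℝ) (M : ℝ), 0 < M →
        AnalyticOnNhd ℝ f (Metric.ball (0 : Esp n) R) →
        (∀ α : Fin n → ℕ, ∀ x ∈ Metric.ball (0 : Esp n) R,
          |mpder α f x| ≤ M * (R * ϱ) ^ (-(mdeg α : ℝ)) * (Nat.factorial (mdeg α) : ℝ)) →
      ∀ x ∈ Metric.ball (0 : Esp n) R,
        |f x| ≤ N * M ^ (1 - θ) * ((volume ω).toReal⁻¹ * ∫ y in ω, |f y|) ^ θ := by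
  have hn0 : (0:ℝ) < n := by exact_mod_cast hn
  have hn1 : (1:ℝ) ≤ n := by exact_mod_cast hn
  set D : ℝ := 2 * n / ϱ with hD
  have hD0 : 0 < D := by positivity
  have hδ1 : ϱ ^ 2 / (32 * n) ≤ 1 := by
    rw [div_le_one (by positivity)]; nlinarith
  obtain ⟨N, θ, hN, hθ0, hθ1, hmain⟩ := aux_oneD (2 * D) (ϱ ^ 2 / (32 * n)) (by positivity)
    (by positivity) hδ1
  refine ⟨N * 2 ^ θ, θ, hθ0, hθ1, ?_⟩
  intro R hR ω hω hωs hωv f M hM hf hder x hx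
  set B := Metric.ball (0 : Esp n) R with hB
  have hBo : IsOpen B := Metric.isOpen_ball
  have hBfin : volume B ≠ ⊤ := measure_ball_lt_top.ne
  have hωfin : volume ω ≠ ⊤ := ((measure_mono hωs).trans_lt hBfin.lt_top).ne
  have hV0 : 0 < (volume B).toReal :=
    ENNReal.toReal_pos (Metric.measure_ball_pos _ _ hR).ne' hBfin
  have hω0 : 0 < (volume ω).toReal := lt_of_lt_of_le (by positivity) hωv
  have hfc : ContinuousOn f B := hf.continuousOn
  have hfM : ∀ y ∈ B, |f y| ≤ M := by
    intro y hy
    have h0 : mpder (fun _ : Fin n => 0) f = f := by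
      rw [mpder_eq_dl]
      have : (List.finRange n).flatMap (fun i => List.replicate 0 i) = [] := by simp
      rw [this]; rfl
    have := hder (fun _ => 0) y hy
    rw [h0] at this
    simpa [mdeg] using this
  have hfint : IntegrableOn (fun y => |f y|) ω := by
    refine ⟨?_, HasFiniteIntegral.restrict_of_bounded M hωfin.lt_top ?_⟩
    · exact ((hfc.abs.mono hωs).aestronglyMeasurable hω)
    · rw [ae_restrict_iff' hω]
      refine Filter.Eventually.of_forall fun y hy => ?_
      rw [Real.norm_eq_abs, abs_abs]
      exact hfM y (hωs hy)
  set avg := (volume ω).toReal⁻¹ * ∫ y in ω, |f y| with havg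
  have hI0 : 0 ≤ ∫ y in ω, |f y| := integral_nonneg fun y => abs_nonneg _
  have havg0 : 0 ≤ avg := by positivity
  have key : ∀ a, avg < a → |f x| ≤ N * 2 ^ θ * M ^ (1 - θ) * a ^ θ := by
    intro a ha
    have ha0 : 0 < a := lt_of_le_of_lt havg0 ha
    set ω' := ω \ (B ∩ (fun y => |f y|) ⁻¹' (Set.Ioi (2 * a))) with hω'
    have hUo : IsOpen (B ∩ (fun y => |f y|) ⁻¹' (Set.Ioi (2 * a))) :=
      hfc.abs.isOpen_inter_preimage hBo isOpen_Ioi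
    have hω'm : MeasurableSet ω' := hω.diff hUo.measurableSet
    have hω's : ω' ⊆ B := Set.sdiff_subset.trans hωs
    have hω'b : ∀ y ∈ ω', |f y| ≤ 2 * a := by
      intro y hy
      by_contra h
      push Not at h
      exact hy.2 ⟨hωs hy.1, h⟩
    have hω'v : ϱ / 2 * volume.real B ≤ volume.real ω' := by
      have h1 := mul_meas_ge_le_integral_of_nonneg (μ := volume.restrict ω)
        (f := fun y => |f y|) (Filter.Eventually.of_forall fun y => abs_nonneg _) hfint (2 * a)
      have h2 : volume.real (ω ∩ {y | 2 * a ≤ |f y|}) ≤ 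
          (volume.restrict ω).real {y | 2 * a ≤ |f y|} := by
        rw [measureReal_def, measureReal_def]
        apply ENNReal.toReal_mono
        · exact (measure_ne_top_of_subset (Set.subset_univ _) (by simpa using hωfin))
        · rw [Set.inter_comm]; exact Measure.le_restrict_apply _ _
      have h3 : ω ⊆ ω' ∪ (ω ∩ {y | 2 * a ≤ |f y|}) := by
        intro y hy
        by_cases h : 2 * a < |f y|
        · right; exact ⟨hy, h.le⟩
        · left; exact ⟨hy, fun hh => h hh.2⟩
      have h4 := (measureReal_mono h3 (ne_top_of_le_ne_top hωfin (measure_mono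
        (Set.union_subset Set.sdiff_subset Set.inter_subset_left)))).trans
          (measureReal_union_le _ _)
      have h5 : ∫ y in ω, |f y| ≤ a * volume.real ω := by
        have : ∫ y in ω, |f y| = avg * (volume ω).toReal := by
          rw [havg]; field_simp
        rw [this, measureReal_def]
        exact mul_le_mul_of_nonneg_right ha.le hω0.le
      have h6 : a * (2 * volume.real (ω ∩ {y | 2 * a ≤ |f y|})) ≤ a * volume.real ω := by
        have := mul_le_mul_of_nonneg_left h2 (by positivity : 0 ≤ 2 * a)
        linarith
      have h7 := le_of_mul_le_mul_left h6 ha0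
      have h8 : ϱ * volume.real B ≤ volume.real ω := hωv
      linarith
    obtain ⟨y, hy, hyE⟩ := geom hn ϱ R hϱ0 hϱ1 hR ω' hω'm hω's hω'v x hx
    set v := y - x with hv
    have hvn : ∀ i, |v i| ≤ 2 * R := by
      intro i
      have h1 : ‖v i‖ ≤ ‖v‖ := PiLp.norm_apply_le v i
      have h2 : ‖v‖ ≤ ‖y‖ + ‖x‖ := norm_sub_le _ _
      have h3 : ‖y‖ < R := by simpa [hB] using hy
      have h4 : ‖x‖ < R := by simpa [hB] using hx
      rw [Real.norm_eq_abs] at h1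
      linarith
    have hseg : ∀ t ∈ Set.Icc (0:ℝ) 1, x + t • v ∈ B := fun t ht =>
      (convex_ball (0 : Esp n) R).add_smul_sub_mem hx hy ht
    have hbd : ∀ k, ∀ z ∈ B, |iteratedFDeriv ℝ k f z (fun _ => v)| ≤
        M * (D ^ k * k.factorial) := by
      intro k z hz
      have h1 := iter_bound hBo f hf k (M * ((R * ϱ)⁻¹ ^ k) * k.factorial) (2 * R) v hvn z hz (by
        intro α hα
        have := hder α z hz
        rw [hα, Real.rpow_neg (by positivity), Real.rpow_natCast] at this
        rwa [inv_pow])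
      refine h1.trans (le_of_eq ?_)
      have : D = (R * ϱ)⁻¹ * (n * (2 * R)) := by rw [hD]; field_simp
      rw [this, mul_pow (R * ϱ)⁻¹]
      ring
    set u : Esp n → ℝ := fun z => M⁻¹ • f z with hu
    have hua : AnalyticOnNhd ℝ u B := fun z hz => by
      have h1 : AnalyticAt ℝ (M⁻¹ • f) z := (hf z hz).const_smul
      exact h1
    have hub : ∀ k, ∀ z ∈ B, |iteratedFDeriv ℝ k u z (fun _ => v)| ≤ D ^ k * k.factorial := by
      intro k z hz
      have h1 : iteratedFDeriv ℝ k u z = M⁻¹ • iteratedFDeriv ℝ k f z :=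
        iteratedFDeriv_const_smul_apply (a := M⁻¹) (i := k) (f := f) (hf z hz).contDiffAt
      rw [h1, ContinuousMultilinearMap.smul_apply, smul_eq_mul, abs_mul, abs_of_pos (by positivity)]
      rw [inv_mul_le_iff₀ hM]
      exact hbd k z hz
    have htay := line_taylor hBo u hua x v hseg D hD0 hub
    have hfin := hmain (fun t => u (x + t • v)) htay _ (2 * a / M) (by positivity)
      (fun t ht => ht.1) hyE (by
        intro t ht
        have := hω'b _ ht.2
        simp only [hu, smul_eq_mul]
        rw [abs_mul, abs_of_pos (by positivity), inv_mul_eq_div]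
        gcongr)
    simp only [hu, zero_smul, add_zero, smul_eq_mul] at hfin
    rw [abs_mul, abs_of_pos (by positivity), inv_mul_le_iff₀ hM, 
      Real.div_rpow (by positivity) hM.le, Real.mul_rpow (by norm_num) ha0.le] at hfin
    refine hfin.trans (le_of_eq ?_)
    rw [Real.rpow_sub hM, Real.rpow_one]
    ring
  have hcont : ContinuousAt (fun a : ℝ => N * 2 ^ θ * M ^ (1 - θ) * a ^ θ) avg :=
    (Real.continuousAt_rpow_const avg θ (Or.inr hθ0.le)).const_mul _
  have htend : Filter.Tendsto (fun a : ℝ => N * 2 ^ θ * M ^ (1 - θ) * a ^ θ)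
      (nhdsWithin avg (Set.Ioi avg)) (nhds (N * 2 ^ θ * M ^ (1 - θ) * avg ^ θ)) :=
    hcont.tendsto.mono_left nhdsWithin_le_nhds
  exact ge_of_tendsto htend (by
    filter_upwards [self_mem_nhdsWithin] with a ha
    exact key a ha)

end
end

section
/- Let n ≥ 1, let γ ∈ ℕⁿ be a multi-index and let 0 < t < s be real numbers. Then Σ_{β<γ} C(γ,β) |γ−β|! |β|! s^{−|γ|+|β|} t^{−|β|} ≤ |γ|! t^{1−|γ|} / (s−t), where the sum runs over all multi-indices β ∈ ℕⁿ with β ≤ γ componentwise and β ≠ γ. -/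
open MeasureTheory Finset Set

noncomputable section

lemma aux_vand {n : ℕ} (γ : Fin n → ℕ) (k : ℕ) :
    ∑ β ∈ (Fintype.piFinset fun i => Finset.Iic (γ i)).filter (fun β => mdeg β = k),
      (∏ i, (γ i).choose (β i)) = (mdeg γ).choose k := by
  have h : ((Polynomial.X + 1 : Polynomial ℕ)) ^ (mdeg γ) =
      ∑ β ∈ (Fintype.piFinset fun i => Finset.Iic (γ i)),
        Polynomial.monomial (mdeg β) (∏ i, (γ i).choose (β i)) := by
    unfold mdeg
    rw [← Finset.prod_pow_eq_pow_sum]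
    have h1 : ∀ i, (Polynomial.X + 1 : Polynomial ℕ) ^ (γ i) =
        ∑ j ∈ Finset.Iic (γ i), Polynomial.monomial j ((γ i).choose j) := by
      intro i
      rw [add_pow]
      have : Finset.Iic (γ i) = Finset.range (γ i + 1) := by ext j; simp only [Finset.mem_Iic, Finset.mem_range]; omega
      rw [this]
      refine Finset.sum_congr rfl fun j _ => ?_
      rw [← Polynomial.C_mul_X_pow_eq_monomial]
      simp [mul_comm]
    simp_rw [h1]
    rw [Finset.prod_univ_sum]
    refine Finset.sum_congr rfl fun β _ => ?_
    simp_rw [← Polynomial.C_mul_X_pow_eq_monomial]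
    rw [Finset.prod_mul_distrib, Finset.prod_pow_eq_pow_sum, map_prod]
  have h2 := congrArg (fun p => Polynomial.coeff p k) h
  simp only [Polynomial.finsetSum_coeff, Polynomial.coeff_monomial,
    Polynomial.coeff_X_add_one_pow] at h2
  rw [Finset.sum_filter]
  simpa using h2.symm

lemma aux_geom (N : ℕ) (t s : ℝ) (ht : 0 < t) (hts : t < s) :
    ∑ k ∈ Finset.range N, s ^ ((k : ℝ) - (N : ℝ)) * t ^ (-(k : ℝ)) ≤
      t ^ (1 - (N : ℝ)) / (s - t) := by
  have hs : 0 < s := ht.trans hts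
  have hd : 0 < s - t := sub_pos.2 hts
  have h1 : ∀ k ∈ Finset.range N, s ^ ((k : ℝ) - (N : ℝ)) * t ^ (-(k : ℝ)) =
      (s / t) ^ k * (s ^ N)⁻¹ := by
    intro k _
    rw [Real.rpow_sub hs, Real.rpow_neg ht.le, Real.rpow_natCast, Real.rpow_natCast,
      Real.rpow_natCast, div_pow]
    field_simp
  have hne : s / t ≠ 1 := by
    rw [Ne, div_eq_one_iff_eq ht.ne']; exact hts.ne'
  rw [Finset.sum_congr rfl h1, ← Finset.sum_mul, geom_sum_eq hne, Real.rpow_sub ht,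
    Real.rpow_one, Real.rpow_natCast]
  have e1 : ((s / t) ^ N - 1) / (s / t - 1) * (s ^ N)⁻¹ =
      t / t ^ N / (s - t) - t / (s - t) / s ^ N := by
    have : s / t - 1 = (s - t) / t := by field_simp
    rw [this, div_pow]
    field_simp
  rw [e1]
  have : 0 ≤ t / (s - t) / s ^ N := by positivity
  linarith

/-- the combinatorial multi-index inequality (Lemma `L:postleibniz`). -/
theorem stmt17 (n : ℕ) (hn : 0 < n) (γ : Fin n → ℕ) (t s : ℝ)
    (ht : 0 < t) (hts : t < s) :
    ∑ β ∈ (Fintype.piFinset fun i => Finset.Iic (γ i)).filter (· ≠ γ),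
        (((∏ i, (γ i).choose (β i)) * Nat.factorial (mdeg (γ - β)) *
            Nat.factorial (mdeg β) : ℕ) : ℝ) *
          s ^ ((mdeg β : ℝ) - (mdeg γ : ℝ)) * t ^ (-(mdeg β : ℝ)) ≤
      (Nat.factorial (mdeg γ) : ℝ) * t ^ (1 - (mdeg γ : ℝ)) / (s - t) := by
  set N := mdeg γ with hN
  have hset : (Fintype.piFinset fun i => Finset.Iic (γ i)).filter (· ≠ γ) =
      (Fintype.piFinset fun i => Finset.Iic (γ i)).filter (fun β => mdeg β < N) := by
    apply Finset.filter_congr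
    intro β hβ
    have hle : ∀ i, β i ≤ γ i := by simpa using hβ
    constructor
    · intro hne
      obtain ⟨i, hi⟩ := Function.ne_iff.1 hne
      exact Finset.sum_lt_sum (fun i _ => hle i)
        ⟨i, Finset.mem_univ i, lt_of_le_of_ne (hle i) hi⟩
    · rintro hlt rfl
      exact lt_irrefl _ hlt
  have hmaps : ∀ β ∈ (Fintype.piFinset fun i => Finset.Iic (γ i)).filter (fun β => mdeg β < N),
      mdeg β ∈ Finset.range N := by
    intro β hβ
    exact Finset.mem_range.2 (Finset.mem_filter.1 hβ).2
  rw [hset, ← Finset.sum_fiberwise_of_maps_to hmaps]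
  have key : ∀ k ∈ Finset.range N,
      ∑ β ∈ ((Fintype.piFinset fun i => Finset.Iic (γ i)).filter
          (fun β => mdeg β < N)).filter (fun β => mdeg β = k),
        (((∏ i, (γ i).choose (β i)) * Nat.factorial (mdeg (γ - β)) *
            Nat.factorial (mdeg β) : ℕ) : ℝ) *
          s ^ ((mdeg β : ℝ) - (N : ℝ)) * t ^ (-(mdeg β : ℝ)) =
      (Nat.factorial N : ℝ) * (s ^ ((k : ℝ) - (N : ℝ)) * t ^ (-(k : ℝ))) := by
    intro k hk
    have hkN := Finset.mem_range.1 hk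
    have hf : ((Fintype.piFinset fun i => Finset.Iic (γ i)).filter
          (fun β => mdeg β < N)).filter (fun β => mdeg β = k) =
        (Fintype.piFinset fun i => Finset.Iic (γ i)).filter (fun β => mdeg β = k) := by
      rw [Finset.filter_filter]
      apply Finset.filter_congr
      intro β _
      constructor
      · exact fun h => h.2
      · exact fun h => ⟨h ▸ hkN, h⟩
    rw [hf]
    have hterm : ∀ β ∈ (Fintype.piFinset fun i => Finset.Iic (γ i)).filter
          (fun β => mdeg β = k),
        (((∏ i, (γ i).choose (β i)) * Nat.factorial (mdeg (γ - β)) *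
            Nat.factorial (mdeg β) : ℕ) : ℝ) *
          s ^ ((mdeg β : ℝ) - (N : ℝ)) * t ^ (-(mdeg β : ℝ)) =
        ((∏ i, (γ i).choose (β i) : ℕ) : ℝ) *
          (((Nat.factorial (N - k) * Nat.factorial k : ℕ) : ℝ) *
            (s ^ ((k : ℝ) - (N : ℝ)) * t ^ (-(k : ℝ)))) := by
      intro β hβ
      obtain ⟨h1, h2⟩ := Finset.mem_filter.1 hβ
      have hle : ∀ i, β i ≤ γ i := by simpa using h1
      have h3 : mdeg (γ - β) = N - k := by
        have : mdeg (γ - β) + mdeg β = N := by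
          rw [hN]
          unfold mdeg
          rw [← Finset.sum_add_distrib]
          exact Finset.sum_congr rfl fun i _ => Nat.sub_add_cancel (hle i)
        omega
      rw [h3, h2]
      push_cast
      ring
    rw [Finset.sum_congr rfl hterm, ← Finset.sum_mul, ← Nat.cast_sum, aux_vand, ← mul_assoc,
      ← Nat.cast_mul, ← Nat.choose_mul_factorial_mul_factorial hkN.le]
    congr 2
    rw [← hN]
    ring
  rw [Finset.sum_congr rfl key, ← Finset.mul_sum, mul_div_assoc]
  exact mul_le_mul_of_nonneg_left (aux_geom N t s ht hts) (Nat.cast_nonneg _)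

end
end

section
/- Let m ≥ 1, let Ω ⊂ ℝⁿ be open, let j ∈ {m+1, …, 2m}, let a ∈ C^{j−m}(Ω) and let α ∈ ℕⁿ be a multi-index with |α| ≤ j. Then there exist functions b_{γβ} : Ω → ℝ, indexed by pairs of multi-indices γ, β with |γ| ≤ m and |β| ≤ m, with each b_{γβ} of class C^{|γ|}, such that for every u ∈ C^∞(Ω): a ∂^α u = Σ_{|γ|,|β|≤m} ∂^γ (b_{γβ} ∂^β u) on Ω. -/
open MeasureTheory Finset Set

noncomputable section

/-- Derivative along a word of directions. -/
def wD {n : ℕ} (w : List (Fin n)) (v : Esp n → ℝ) : Esp n → ℝ := w.foldr pder v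

/-- The word of a multi-index. -/
def wrd {n : ℕ} (α : Fin n → ℕ) : List (Fin n) :=
  (List.finRange n).flatMap fun i => List.replicate (α i) i

theorem wD_append {n : ℕ} (w w' : List (Fin n)) (v : Esp n → ℝ) :
    wD (w ++ w') v = wD w (wD w' v) := by
  simp [wD, List.foldr_append]

theorem wD_replicate {n : ℕ} (i : Fin n) (k : ℕ) (v : Esp n → ℝ) :
    wD (List.replicate k i) v = (pder i)^[k] v := by
  induction k with
  | zero => rfl
  | succ k ih =>
    rw [Function.iterate_succ_apply', ← ih]; rfl

theorem mpder_eq_wD {n : ℕ} (α : Fin n → ℕ) (v : Esp n → ℝ) :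
    mpder α v = wD (wrd α) v := by
  unfold mpder wrd
  generalize List.finRange n = l
  induction l with
  | nil => rfl
  | cons i l ih =>
    rw [List.flatMap_cons, wD_append, wD_replicate, List.foldr_cons, ih]

theorem wrd_length {n : ℕ} (α : Fin n → ℕ) : (wrd α).length = mdeg α := by
  unfold wrd mdeg
  rw [List.length_flatMap, ← List.sum_ofFn, List.ofFn_eq_map]
  simp

theorem wrd_count {n : ℕ} (α : Fin n → ℕ) (i : Fin n) : (wrd α).count i = α i := by
  unfold wrd
  rw [List.count_flatMap]
  have : (List.count i ∘ fun j : Fin n => List.replicate (α j) j)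
      = fun j => if j = i then α j else 0 := by
    funext j
    simp [List.count_replicate]
  rw [this, ← List.ofFn_eq_map, List.sum_ofFn]
  simp

theorem wrd_add_single {n : ℕ} (α : Fin n → ℕ) (i : Fin n) :
    (wrd (α + Pi.single i 1)).Perm (i :: wrd α) := by
  rw [List.perm_iff_count]
  intro j
  rw [List.count_cons, wrd_count, wrd_count]
  by_cases h : i = j
  · subst h; simp
  · simp [h, Ne.symm h]

theorem mdeg_add_single {n : ℕ} (α : Fin n → ℕ) (i : Fin n) :
    mdeg (α + Pi.single i 1) = mdeg α + 1 := by
  rw [← wrd_length, ← wrd_length, (wrd_add_single α i).length_eq]; rfl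

theorem pder_contDiffOn {n : ℕ} {Ω : Set (Esp n)} (hΩ : IsOpen Ω) (i : Fin n) {k : ℕ}
    {v : Esp n → ℝ} (hv : ContDiffOn ℝ (k + 1 : ℕ) v Ω) : ContDiffOn ℝ (k : ℕ) (pder i v) Ω := by
  have h := hv.fderiv_of_isOpen hΩ (m := (k : ℕ)) (by norm_cast)
  exact h.clm_apply contDiffOn_const

theorem pder_congr {n : ℕ} {Ω : Set (Esp n)} (hΩ : IsOpen Ω) (i : Fin n)
    {v w : Esp n → ℝ} (h : EqOn v w Ω) : EqOn (pder i v) (pder i w) Ω := by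
  intro x hx
  unfold pder
  rw [(h.eventuallyEq_of_mem (hΩ.mem_nhds hx)).fderiv_eq]

theorem wD_contDiffOn {n : ℕ} {Ω : Set (Esp n)} (hΩ : IsOpen Ω) (w : List (Fin n)) {k : ℕ}
    {v : Esp n → ℝ} (hv : ContDiffOn ℝ (k + w.length : ℕ) v Ω) :
    ContDiffOn ℝ (k : ℕ) (wD w v) Ω := by
  induction w generalizing k with
  | nil => exact hv
  | cons i w ih =>
    refine pder_contDiffOn hΩ i (ih (k := k + 1) ?_)
    rw [List.length_cons] at hv
    rwa [show k + 1 + w.length = k + (w.length + 1) by ring]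

theorem wD_congr {n : ℕ} {Ω : Set (Esp n)} (hΩ : IsOpen Ω) (w : List (Fin n))
    {v v' : Esp n → ℝ} (h : EqOn v v' Ω) : EqOn (wD w v) (wD w v') Ω := by
  induction w with
  | nil => exact h
  | cons i w ih => exact pder_congr hΩ i ih

theorem wD_sub {n : ℕ} {Ω : Set (Esp n)} (hΩ : IsOpen Ω) (w : List (Fin n))
    {v v' : Esp n → ℝ} (hv : ContDiffOn ℝ (w.length : ℕ) v Ω)
    (hv' : ContDiffOn ℝ (w.length : ℕ) v' Ω) :
    EqOn (wD w (fun y => v y - v' y)) (fun y => wD w v y - wD w v' y) Ω := by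
  induction w with
  | nil => intro x _; rfl
  | cons i w ih =>
    have e := ih (hv.of_le (by norm_cast; simp)) (hv'.of_le (by norm_cast; simp))
    have e2 := pder_congr hΩ i e
    have d1 : ContDiffOn ℝ (1 : ℕ) (wD w v) Ω := wD_contDiffOn hΩ w (by
      rw [List.length_cons] at hv; rwa [add_comm])
    have d2 : ContDiffOn ℝ (1 : ℕ) (wD w v') Ω := wD_contDiffOn hΩ w (by
      rw [List.length_cons] at hv'; rwa [add_comm])
    intro x hx
    refine (e2 hx).trans ?_
    have f1 := (d1.contDiffAt (hΩ.mem_nhds hx)).differentiableAt (by simp)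
    have f2 := (d2.contDiffAt (hΩ.mem_nhds hx)).differentiableAt (by simp)
    change fderiv ℝ (fun y => wD w v y - wD w v' y) x _ = _
    rw [fderiv_fun_sub f1 f2]
    rfl

theorem pder_comm {n : ℕ} {Ω : Set (Esp n)} (hΩ : IsOpen Ω) (i j : Fin n)
    {v : Esp n → ℝ} (hv : ContDiffOn ℝ (2 : ℕ) v Ω) :
    EqOn (pder i (pder j v)) (pder j (pder i v)) Ω := by
  intro x hx
  have hat := hv.contDiffAt (hΩ.mem_nhds hx)
  have hs := hat.isSymmSndFDerivAt (by simp)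
  have hd : DifferentiableAt ℝ (fderiv ℝ v) x :=
    (hat.fderiv_right (m := 1) (by norm_num)).differentiableAt (by simp)
  have key : ∀ k l : Fin n, pder k (pder l v) x =
      fderiv ℝ (fderiv ℝ v) x (EuclideanSpace.single k 1) (EuclideanSpace.single l 1) := by
    intro k l
    change fderiv ℝ (fun y => fderiv ℝ v y (EuclideanSpace.single l 1)) x _ = _
    rw [fderiv_clm_apply hd (differentiableAt_const _)]
    simp
  rw [key, key, hs]

theorem wD_perm {n : ℕ} {Ω : Set (Esp n)} (hΩ : IsOpen Ω) {w w' : List (Fin n)} (p : w.Perm w')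
    {v : Esp n → ℝ} (hv : ContDiffOn ℝ (w.length : ℕ) v Ω) : EqOn (wD w v) (wD w' v) Ω := by
  induction p with
  | nil => intro x _; rfl
  | cons i p ih => exact pder_congr hΩ i (ih (hv.of_le (by norm_cast; simp)))
  | swap i j l =>
    refine pder_comm hΩ j i (wD_contDiffOn hΩ l ?_)
    rw [List.length_cons, List.length_cons] at hv
    rwa [show 2 + l.length = l.length + 1 + 1 by ring]
  | trans p q ih1 ih2 => exact (ih1 hv).trans (ih2 (by rwa [← p.length_eq]))

theorem mpder_contDiffOn {n : ℕ} {Ω : Set (Esp n)} (hΩ : IsOpen Ω) (α : Fin n → ℕ) {k : ℕ}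
    {v : Esp n → ℝ} (hv : ContDiffOn ℝ (⊤ : ℕ∞) v Ω) :
    ContDiffOn ℝ (k : ℕ) (mpder α v) Ω := by
  rw [mpder_eq_wD]
  exact wD_contDiffOn hΩ _ (hv.of_le (by exact_mod_cast le_top))

/-- Operators in variational form. -/
def VarForm (n m : ℕ) (Ω : Set (Esp n)) (T : (Esp n → ℝ) → Esp n → ℝ) : Prop :=
  ∃ b : (Fin n → ℕ) → (Fin n → ℕ) → Esp n → ℝ,
      (∀ γ ∈ idxLE n m, ∀ β ∈ idxLE n m, ContDiffOn ℝ (mdeg γ : ℕ) (b γ β) Ω) ∧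
      ∀ u : Esp n → ℝ, ContDiffOn ℝ (⊤ : ℕ∞) u Ω → ∀ x ∈ Ω,
        T u x = ∑ γ ∈ idxLE n m, ∑ β ∈ idxLE n m,
            mpder γ (fun y => b γ β y * mpder β u y) x

theorem mem_idxLE {n m : ℕ} {α : Fin n → ℕ} : α ∈ idxLE n m ↔ mdeg α ≤ m := by
  unfold idxLE
  rw [Finset.mem_filter, Fintype.mem_piFinset]
  refine ⟨fun h => h.2, fun h => ⟨fun i => ?_, h⟩⟩
  have : α i ≤ mdeg α := Finset.single_le_sum (f := α) (fun _ _ => Nat.zero_le _) (Finset.mem_univ i)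
  rw [Finset.mem_range]; omega

theorem wD_zero {n : ℕ} (w : List (Fin n)) : wD w (fun _ => 0) = fun _ => (0 : ℝ) := by
  induction w with
  | nil => rfl
  | cons i w ih =>
    change pder i (wD w _) = _
    rw [ih]; funext x; simp [pder]

theorem VarForm.single {n m : ℕ} {Ω : Set (Esp n)} (γ β : Fin n → ℕ)
    (hγ : mdeg γ ≤ m) (hβ : mdeg β ≤ m) (a : Esp n → ℝ) (ha : ContDiffOn ℝ (mdeg γ : ℕ) a Ω) :
    VarForm n m Ω (fun u => mpder γ (fun y => a y * mpder β u y)) := by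
  classical
  refine ⟨fun γ' β' => if γ' = γ ∧ β' = β then a else fun _ => 0, ?_, ?_⟩
  · intro γ' _ β' _
    dsimp only
    split_ifs with h
    · rw [h.1]; exact ha
    · exact contDiffOn_const
  · intro u _ x _
    rw [Finset.sum_eq_single_of_mem γ (mem_idxLE.2 hγ),
      Finset.sum_eq_single_of_mem β (mem_idxLE.2 hβ)]
    · simp
    · intro β' _ h
      simp [h, mpder_eq_wD, wD_zero]
    · intro γ' _ h
      simp [h, mpder_eq_wD, wD_zero]

theorem VarForm.sub {n m : ℕ} {Ω : Set (Esp n)} (hΩ : IsOpen Ω)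
    {T S R : (Esp n → ℝ) → Esp n → ℝ}
    (hT : VarForm n m Ω T) (hS : VarForm n m Ω S)
    (h : ∀ u : Esp n → ℝ, ContDiffOn ℝ (⊤ : ℕ∞) u Ω → ∀ x ∈ Ω, R u x = T u x - S u x) :
    VarForm n m Ω R := by
  obtain ⟨b, hb, eb⟩ := hT
  obtain ⟨c, hc, ec⟩ := hS
  refine ⟨fun γ β y => b γ β y - c γ β y, fun γ hγ β hβ => (hb γ hγ β hβ).sub (hc γ hγ β hβ), ?_⟩
  intro u hu x hx
  rw [h u hu x hx, eb u hu x hx, ec u hu x hx, ← Finset.sum_sub_distrib]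
  refine Finset.sum_congr rfl fun γ hγ => ?_
  rw [← Finset.sum_sub_distrib]
  refine Finset.sum_congr rfl fun β hβ => ?_
  have hu' := mpder_contDiffOn hΩ β (k := mdeg γ) hu
  have := wD_sub hΩ (wrd γ) (v := fun y => b γ β y * mpder β u y)
    (v' := fun y => c γ β y * mpder β u y)
    (by rw [wrd_length]; exact (hb γ hγ β hβ).mul hu')
    (by rw [wrd_length]; exact (hc γ hγ β hβ).mul hu') hx
  simp only [sub_mul]
  rw [← mpder_eq_wD] at this
  simp only [← mpder_eq_wD] at this
  exact this.symm

theorem exists_pred {n : ℕ} (α : Fin n → ℕ) (h : 0 < mdeg α) :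
    ∃ (β : Fin n → ℕ) (i : Fin n), α = β + Pi.single i 1 := by
  have : ∃ i, α i ≠ 0 := by
    by_contra! hc
    simp [mdeg, hc] at h
  obtain ⟨i, hi⟩ := this
  refine ⟨α - Pi.single i 1, i, ?_⟩
  funext j
  by_cases hj : j = i
  · subst hj; simp; omega
  · simp [hj]

theorem varForm_main {n m : ℕ} {Ω : Set (Esp n)} (hΩ : IsOpen Ω) (k : ℕ) :
    ∀ (γ α : Fin n → ℕ) (a : Esp n → ℝ), mdeg γ + k ≤ m → mdeg α ≤ m + k →
      ContDiffOn ℝ (mdeg γ + k : ℕ) a Ω →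
      VarForm n m Ω (fun u => mpder γ (fun y => a y * mpder α u y)) := by
  induction k with
  | zero => intro γ α a h1 h2 ha; exact VarForm.single γ α h1 h2 a ha
  | succ k ih =>
    intro γ α a h1 h2 ha
    by_cases h0 : mdeg α = 0
    · exact VarForm.single γ α (by omega) (by omega) a (ha.of_le (by norm_cast; omega))
    obtain ⟨β, i, rfl⟩ := exists_pred α (by omega)
    rw [mdeg_add_single] at h2
    have t1 := ih (γ + Pi.single i 1) β a (by rw [mdeg_add_single]; omega) (by omega)
      (by rw [mdeg_add_single, show mdeg γ + 1 + k = mdeg γ + (k + 1) by ring]; exact ha)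
    have hpa : ContDiffOn ℝ (mdeg γ + k : ℕ) (pder i a) Ω := pder_contDiffOn hΩ i ha
    have t2 := ih γ β (pder i a) (by omega) (by omega) hpa
    refine VarForm.sub hΩ t1 t2 ?_
    intro u hu x hx
    have hβ : ∀ l : ℕ, ContDiffOn ℝ (l : ℕ) (mpder β u) Ω := fun l => mpder_contDiffOn hΩ β hu
    have ha1 : ContDiffOn ℝ (mdeg γ + 1 : ℕ) a Ω := ha.of_le (by norm_cast; omega)
    have hprod : ContDiffOn ℝ (mdeg γ + 1 : ℕ) (fun y => a y * mpder β u y) Ω := ha1.mul (hβ _)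
    -- the derivative of the product
    have e1 : EqOn (fun y => a y * mpder (β + Pi.single i 1) u y)
        (fun y => pder i (fun z => a z * mpder β u z) y - pder i a y * mpder β u y) Ω := by
      intro y hy
      have p : mpder (β + Pi.single i 1) u y = pder i (mpder β u) y := by
        rw [mpder_eq_wD, mpder_eq_wD]
        exact wD_perm hΩ (wrd_add_single β i) (hu.of_le (by exact_mod_cast le_top)) hy
      have f1 := (ha1.contDiffAt (hΩ.mem_nhds hy)).differentiableAt (by norm_cast)
      have f2 := ((hβ 1).contDiffAt (hΩ.mem_nhds hy)).differentiableAt (by simp)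
      dsimp only
      rw [p]
      have q : pder i (fun z => a z * mpder β u z) y
          = a y * pder i (mpder β u) y + mpder β u y * pder i a y := by
        unfold pder
        rw [fderiv_fun_mul f1 f2]
        simp
      rw [q]; ring
    have e2 : mpder (γ + Pi.single i 1) (fun y => a y * mpder β u y) x
        = wD (wrd γ) (pder i (fun y => a y * mpder β u y)) x := by
      have hp : (wrd (γ + Pi.single i 1)).Perm (wrd γ ++ [i]) :=
        (wrd_add_single γ i).trans (List.perm_append_singleton i _).symm
      rw [mpder_eq_wD]
      have := wD_perm hΩ hp (v := fun y => a y * mpder β u y)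
        (by rw [wrd_length, mdeg_add_single]; exact hprod) hx
      rw [this, wD_append]; rfl
    have e3 := wD_sub hΩ (wrd γ) (v := pder i (fun z => a z * mpder β u z))
      (v' := fun y => pder i a y * mpder β u y)
      (by rw [wrd_length]; exact pder_contDiffOn hΩ i hprod)
      (by rw [wrd_length]; exact (hpa.of_le (by norm_cast; omega)).mul (hβ _)) hx
    rw [e2, mpder_eq_wD γ, mpder_eq_wD γ, wD_congr hΩ (wrd γ) e1 hx, e3]

/-- putting a single term a ∂^α into variational form
(Lemma `lemmapuñetero`). -/
theorem stmt19 (n m : ℕ) (hn : 0 < n) (hm : 0 < m) (Ω : Set (Esp n))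
    (hΩ : IsOpen Ω) (j : ℕ) (hj1 : m + 1 ≤ j) (hj2 : j ≤ 2*m)
    (a : Esp n → ℝ) (ha : ContDiffOn ℝ (j - m : ℕ) a Ω)
    (α : Fin n → ℕ) (hα : mdeg α ≤ j) :
    ∃ b : (Fin n → ℕ) → (Fin n → ℕ) → Esp n → ℝ,
      (∀ γ ∈ idxLE n m, ∀ β ∈ idxLE n m, ContDiffOn ℝ (mdeg γ : ℕ) (b γ β) Ω) ∧
      ∀ u : Esp n → ℝ, ContDiffOn ℝ (⊤ : ℕ∞) u Ω → ∀ x ∈ Ω,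
        a x * mpder α u x =
          ∑ γ ∈ idxLE n m, ∑ β ∈ idxLE n m,
            mpder γ (fun y => b γ β y * mpder β u y) x := by
  have h := varForm_main (m := m) hΩ (j - m) (fun _ => 0) α a (by simp [mdeg]; omega) (by omega)
    (by simpa [mdeg] using ha)
  obtain ⟨b, hb, e⟩ := h
  refine ⟨b, hb, fun u hu x hx => ?_⟩
  rw [← e u hu x hx]
  dsimp only
  rw [mpder_eq_wD (fun _ => 0)]
  have : wrd (fun _ : Fin n => 0) = [] := by
    rw [← List.length_eq_zero_iff, wrd_length]; simp [mdeg]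
  rw [this]; rfl

end
end
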